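/- arXiv:2204.03300 — 2 statements merged into one kernel-verified Lean document; each statement's English description precedes it below -/
import Mathlib

section
/- Let ρ>0, μ>0, α>0, β>0, λ>0, γ>0, r>0, c ∈ (0,1), x₀ ∈ ℝ, p₀ ∈ ℝ. Suppose m̄^X ∈ C_{ρ/2}([0,∞);ℝ) satisfies the fixed-point equation m̄^X(t) = e^{−μt} x₀ + ((1−c)/(2r)) ∫_0^t e^{−μ(t−s)} ( ∫_s^∞ e^{−(μ+ρ)(v−s)} m̄^P(v) dv ) ds for all t ≥ 0, where m̄^P is the C¹ solution of (m̄^P)′(t) = α(β − (1−λγ) m̄^X(t) − m̄^P(t)), m̄^P(0) = p₀. Define ū*(t) := ((1−c)/(2r)) ∫_t^∞ e^{−(μ+ρ)(s−t)} m̄^P(s) ds. Then the triple (m̄^P, m̄^X, ū*) consists of C¹ functions satisfying: (m̄^P)′ = α(β − (1−λγ) m̄^X − m̄^P) with m̄^P(0) = p₀; (m̄^X)′ = −μ m̄^X + ū* with m̄^X(0) = x₀; and (ū*)′ = (μ+ρ) ū* − ((1−c)/(2r)) m̄^P with ū*(0) = ((1−c)/(2r)) ∫_0^∞ e^{−(μ+ρ)t}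 m̄^P(t) dt. -/
open MeasureTheory Set

/-- One half of the fundamental theorem of calculus on a closed half-line. -/
theorem hasDerivWithinAt_integral_Ici {f : ℝ → ℝ} (hf : ContinuousOn f (Ici 0)) {t : ℝ}
    (ht : 0 ≤ t) : HasDerivWithinAt (fun x => ∫ s in (0 : ℝ)..x, f s) (f t) (Ici 0) t := by
  have hcont : Continuous (fun v => f (max v 0)) :=
    hf.comp_continuous (by fun_prop) (fun v => le_max_right v 0)
  have hderiv := (hcont.integral_hasStrictDerivAt 0 t).hasDerivAt.hasDerivWithinAt (s := Ici 0)
  rw [max_eq_left ht] at hderiv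
  have heq : ∀ x ∈ Ici (0 : ℝ), ∫ s in (0 : ℝ)..x, f s = ∫ s in (0 : ℝ)..x, f (max s 0) := by
    intro x hx
    refine intervalIntegral.integral_congr fun s hs => ?_
    rw [uIcc_of_le hx] at hs
    simp only [max_eq_left hs.1]
  exact hderiv.congr heq (heq t ht)

theorem contDiffOn_one_Ici_of_hasDerivWithinAt {f f' : ℝ → ℝ}
    (hf : ∀ t ≥ (0 : ℝ), HasDerivWithinAt f (f' t) (Ici 0) t) (hf' : ContinuousOn f' (Ici 0)) :
    ContDiffOn ℝ 1 f (Ici 0) := by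
  rw [contDiffOn_one_iff_derivWithin (uniqueDiffOn_Ici 0)]
  exact ⟨fun t ht => (hf t ht).differentiableWithinAt,
    hf'.congr fun t ht => (hf t ht).derivWithin (uniqueDiffOn_Ici 0 t ht)⟩

/-- A solution of `f' = -α f + h` grows at most exponentially if the forcing term `h` does. -/
theorem abs_le_exp_of_linear_ode {f h : ℝ → ℝ} {α a C : ℝ} (hα : 0 < α) (ha : 0 ≤ a)
    (hf : ∀ t ≥ (0 : ℝ), HasDerivWithinAt f (h t - α * f t) (Ici 0) t)
    (hh : ∀ t ≥ (0 : ℝ), |h t| ≤ C * Real.exp (a * t)) {t : ℝ} (ht : 0 ≤ t) :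
    |f t| ≤ (|f 0| + C / (α + a)) * Real.exp (a * t) := by
  have hαa : 0 < α + a := by positivity
  have hC : 0 ≤ C := by simpa using (abs_nonneg _).trans (hh 0 le_rfl)
  have hF : ∀ x ≥ (0 : ℝ), HasDerivWithinAt (fun x => Real.exp (α * x) * f x)
      (Real.exp (α * x) * h x) (Ici 0) x := by
    intro x hx
    have hexp : HasDerivAt (fun x => Real.exp (α * x)) (Real.exp (α * x) * α) x := by
      simpa using ((hasDerivAt_id x).const_mul α).exp
    exact (hexp.hasDerivWithinAt.mul (hf x hx)).congr_deriv (by ring)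
  have hB : ∀ x, HasDerivAt (fun x => |f 0| + C / (α + a) * Real.exp ((α + a) * x))
      (C * Real.exp ((α + a) * x)) x := by
    intro x
    have hexp : HasDerivAt (fun x => Real.exp ((α + a) * x))
        (Real.exp ((α + a) * x) * (α + a)) x := by
      simpa using ((hasDerivAt_id x).const_mul (α + a)).exp
    exact ((hexp.const_mul (C / (α + a))).const_add |f 0|).congr_deriv (by field_simp)
  have hbound := image_norm_le_of_norm_deriv_right_le_deriv_boundary (a := 0) (b := t)
    (f := fun x => Real.exp (α * x) * f x)
    (fun x hx => (hF x hx.1).continuousWithinAt.mono Icc_subset_Ici_self)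
    (fun x hx => (hF x hx.1).mono (Ici_subset_Ici.2 hx.1)) (by simp; positivity) hB
    (fun x hx => by
      rw [norm_mul, Real.norm_eq_abs, Real.norm_eq_abs, Real.abs_exp, add_mul, Real.exp_add]
      nlinarith [mul_le_mul_of_nonneg_left (hh x hx.1) (Real.exp_pos (α * x)).le])
    (right_mem_Icc.2 ht)
  rw [norm_mul, Real.norm_eq_abs, Real.norm_eq_abs, Real.abs_exp, add_mul, Real.exp_add] at hbound
  have hone : 1 ≤ Real.exp (α * t) * Real.exp (a * t) := by
    rw [← Real.exp_add]
    exact Real.one_le_exp (by positivity)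
  refine le_of_mul_le_mul_left ?_ (Real.exp_pos (α * t))
  nlinarith [mul_le_mul_of_nonneg_left hone (abs_nonneg (f 0))]

/-- A continuous function of exponential growth rate `a < b` is integrable against
`exp (-b v)`. -/
theorem integrableOn_exp_neg_mul_of_abs_le {f : ℝ → ℝ} {a b K : ℝ} (hab : a < b)
    (hf : ContinuousOn f (Ici 0)) (hK : ∀ t ≥ (0 : ℝ), |f t| ≤ K * Real.exp (a * t)) :
    IntegrableOn (fun v => Real.exp (-b * v) * f v) (Ioi 0) := by
  refine integrable_of_isBigO_exp_neg (b := b - a) (sub_pos.2 hab) (by fun_prop) ?_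
  refine Asymptotics.IsBigO.of_bound K ?_
  filter_upwards [Filter.eventually_ge_atTop 0] with t ht
  rw [norm_mul, Real.norm_eq_abs, Real.norm_eq_abs, Real.norm_eq_abs, Real.abs_exp, Real.abs_exp,
    show -(b - a) * t = -b * t + a * t by ring, Real.exp_add]
  nlinarith [mul_le_mul_of_nonneg_left (hK t ht) (Real.exp_pos (-b * t)).le]

/-- The discounted tail integral `∫_t^∞ exp (-b (s - t)) f s ds` solves `y' = b y - f`. -/
theorem hasDerivWithinAt_discounted_tail {f : ℝ → ℝ} {b : ℝ} (hf : ContinuousOn f (Ici 0))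
    (hint : IntegrableOn (fun v => Real.exp (-b * v) * f v) (Ioi 0)) {t : ℝ} (ht : 0 ≤ t) :
    HasDerivWithinAt (fun t => ∫ s in Ioi t, Real.exp (-b * (s - t)) * f s)
      (b * (∫ s in Ioi t, Real.exp (-b * (s - t)) * f s) - f t) (Ici 0) t := by
  set g := fun v => Real.exp (-b * v) * f v with hg
  have hgc : ContinuousOn g (Ici 0) := by fun_prop
  have heq : ∀ x ∈ Ici (0 : ℝ), ∫ s in Ioi x, Real.exp (-b * (s - x)) * f s =
      Real.exp (b * x) * ((∫ s in Ioi 0, g s) - ∫ s in (0 : ℝ)..x, g s) := by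
    intro x hx
    have hsplit := intervalIntegral.integral_Ioi_sub_Ioi hint hx
    rw [← hsplit, sub_sub_cancel, ← integral_const_mul]
    congr 1 with s
    rw [hg, ← mul_assoc, ← Real.exp_add]
    ring_nf
  have hexp : HasDerivAt (fun x => Real.exp (b * x)) (Real.exp (b * t) * b) t := by
    simpa using ((hasDerivAt_id t).const_mul b).exp
  have hderiv := hexp.hasDerivWithinAt.mul
    ((hasDerivWithinAt_integral_Ici hgc ht).const_sub (∫ s in Ioi 0, g s))
  refine (hderiv.congr heq (heq t ht)).congr_deriv ?_
  have hcancel : Real.exp (b * t) * g t = f t := by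
    rw [hg, ← mul_assoc, ← Real.exp_add]
    simp
  rw [heq t ht]
  linear_combination -hcancel

/-- The variation-of-constants formula solves `y' = -μ y + f`. -/
theorem hasDerivWithinAt_variation_of_constants {f : ℝ → ℝ} {μ x₀ : ℝ}
    (hf : ContinuousOn f (Ici 0)) {t : ℝ} (ht : 0 ≤ t) :
    HasDerivWithinAt
      (fun t => Real.exp (-μ * t) * x₀ + ∫ s in (0 : ℝ)..t, Real.exp (-μ * (t - s)) * f s)
      (-μ * (Real.exp (-μ * t) * x₀ + ∫ s in (0 : ℝ)..t, Real.exp (-μ * (t - s)) * f s) + f t)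
      (Ici 0) t := by
  set g := fun s => Real.exp (μ * s) * f s with hg
  have hgc : ContinuousOn g (Ici 0) := by fun_prop
  have heq : ∀ x, Real.exp (-μ * x) * x₀ + ∫ s in (0 : ℝ)..x, Real.exp (-μ * (x - s)) * f s =
      Real.exp (-μ * x) * (x₀ + ∫ s in (0 : ℝ)..x, g s) := by
    intro x
    rw [mul_add, ← intervalIntegral.integral_const_mul]
    congr 2 with s
    rw [hg, ← mul_assoc, ← Real.exp_add]
    ring_nf
  have hexp : HasDerivAt (fun x => Real.exp (-μ * x)) (Real.exp (-μ * t) * -μ) t := by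
    simpa using ((hasDerivAt_id t).const_mul (-μ)).exp
  have hderiv := hexp.hasDerivWithinAt.mul
    ((hasDerivWithinAt_integral_Ici hgc ht).const_add x₀)
  refine (hderiv.congr (fun x _ => heq x) (heq t)).congr_deriv ?_
  have hcancel : Real.exp (-μ * t) * g t = f t := by
    rw [hg, ← mul_assoc, ← Real.exp_add]
    simp
  rw [heq t]
  linear_combination hcancel

/-- If `m̄X ∈ C_{ρ/2}([0,∞);ℝ)` is a fixed point of the mapping `L` (with
`m̄P` the C¹ solution of the price ODE driven by `m̄X`) and
`ū*(t) = ((1−c)/(2r)) ∫_t^∞ e^{−(μ+ρ)(s−t)} m̄P(s) ds`, then `(m̄P, m̄X, ū*)` are C¹ and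
satisfy the coupled system of STATEMENT 6 with the stated initial conditions. -/
theorem stmt_6 (ρ μ α β lam γ r c x₀ p₀ : ℝ)
    (hρ : 0 < ρ) (hμ : 0 < μ) (hα : 0 < α) (hβ : 0 < β) (hlam : 0 < lam) (hγ : 0 < γ)
    (hr : 0 < r) (hc : c ∈ Ioo (0 : ℝ) 1)
    (mX mP : ℝ → ℝ)
    (hmXc : ContinuousOn mX (Ici 0))
    (hmX : ∃ ρ' ∈ Ico (0 : ℝ) ρ, ∃ M : ℝ, ∀ t ≥ (0 : ℝ),
      Real.exp (-(ρ' * t) / 2) * |mX t| ≤ M)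
    (hmPC1 : ContDiffOn ℝ 1 mP (Ici 0))
    (hPode : ∀ t ≥ (0 : ℝ),
      HasDerivWithinAt mP (α * (β - (1 - lam * γ) * mX t - mP t)) (Ici 0) t)
    (hP0 : mP 0 = p₀)
    (hfix : ∀ t ≥ (0 : ℝ), mX t = Real.exp (-μ * t) * x₀ +
      ((1 - c) / (2 * r)) * ∫ s in (0 : ℝ)..t, Real.exp (-μ * (t - s)) *
        ∫ v in Ioi s, Real.exp (-(μ + ρ) * (v - s)) * mP v)
    (u : ℝ → ℝ)
    (hu : ∀ t, u t = ((1 - c) / (2 * r)) *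
      ∫ s in Ioi t, Real.exp (-(μ + ρ) * (s - t)) * mP s) :
    ContDiffOn ℝ 1 mP (Ici 0) ∧ ContDiffOn ℝ 1 mX (Ici 0) ∧ ContDiffOn ℝ 1 u (Ici 0) ∧
    (∀ t ≥ (0 : ℝ),
      HasDerivWithinAt mP (α * (β - (1 - lam * γ) * mX t - mP t)) (Ici 0) t) ∧
    mP 0 = p₀ ∧
    (∀ t ≥ (0 : ℝ), HasDerivWithinAt mX (-μ * mX t + u t) (Ici 0) t) ∧
    mX 0 = x₀ ∧
    (∀ t ≥ (0 : ℝ),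
      HasDerivWithinAt u ((μ + ρ) * u t - ((1 - c) / (2 * r)) * mP t) (Ici 0) t) ∧
    u 0 = ((1 - c) / (2 * r)) * ∫ t in Ioi (0 : ℝ), Real.exp (-(μ + ρ) * t) * mP t := by
  obtain ⟨ρ', ⟨hρ'0, hρ'ρ⟩, M, hM⟩ := hmX
  have hPc : ContinuousOn mP (Ici 0) := hmPC1.continuousOn
  have hXbound : ∀ t ≥ (0 : ℝ), |mX t| ≤ M * Real.exp (ρ' / 2 * t) := by
    intro t ht
    have h := mul_le_mul_of_nonneg_right (hM t ht) (Real.exp_pos (ρ' / 2 * t)).le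
    rwa [mul_right_comm, ← Real.exp_add, show -(ρ' * t) / 2 + ρ' / 2 * t = 0 by ring,
      Real.exp_zero, one_mul] at h
  have hforce : ∀ t ≥ (0 : ℝ), |α * (β - (1 - lam * γ) * mX t)| ≤
      α * (β + |1 - lam * γ| * M) * Real.exp (ρ' / 2 * t) := by
    intro t ht
    have hone : 1 ≤ Real.exp (ρ' / 2 * t) := Real.one_le_exp (by positivity)
    have htri := abs_sub β ((1 - lam * γ) * mX t)
    rw [abs_mul (1 - lam * γ), abs_of_pos hβ] at htri
    rw [abs_mul, abs_of_pos hα, mul_assoc]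
    refine mul_le_mul_of_nonneg_left ?_ hα.le
    nlinarith [mul_le_mul_of_nonneg_left (hXbound t ht) (abs_nonneg (1 - lam * γ))]
  have hPbound := fun t (ht : t ≥ (0 : ℝ)) => abs_le_exp_of_linear_ode hα
    (by positivity : 0 ≤ ρ' / 2) (fun t ht => (hPode t ht).congr_deriv (by ring)) hforce ht
  have hint := integrableOn_exp_neg_mul_of_abs_le (b := μ + ρ) (by linarith) hPc hPbound
  have huode : ∀ t ≥ (0 : ℝ),
      HasDerivWithinAt u ((μ + ρ) * u t - ((1 - c) / (2 * r)) * mP t) (Ici 0) t := by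
    intro t ht
    have h := (hasDerivWithinAt_discounted_tail hPc hint ht).const_mul ((1 - c) / (2 * r))
    refine (h.congr (fun x _ => hu x) (hu t)).congr_deriv ?_
    rw [hu t]
    ring
  have huc : ContinuousOn u (Ici 0) := fun t ht => (huode t ht).continuousWithinAt
  have hXeq : ∀ t ∈ Ici (0 : ℝ), mX t =
      Real.exp (-μ * t) * x₀ + ∫ s in (0 : ℝ)..t, Real.exp (-μ * (t - s)) * u s := by
    intro t ht
    rw [hfix t ht, ← intervalIntegral.integral_const_mul]
    congr 2 with s
    rw [hu s]
    ring
  have hXode : ∀ t ≥ (0 : ℝ), HasDerivWithinAt mX (-μ * mX t + u t) (Ici 0) t := by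
    intro t ht
    rw [hXeq t ht]
    exact (hasDerivWithinAt_variation_of_constants huc ht).congr hXeq (hXeq t ht)
  exact ⟨hmPC1, contDiffOn_one_Ici_of_hasDerivWithinAt hXode (by fun_prop),
    contDiffOn_one_Ici_of_hasDerivWithinAt huode (by fun_prop), hPode, hP0, hXode,
    by simpa using hfix 0 le_rfl, huode, by simpa using hu 0⟩
end

section
/- Let ρ>0, μ>0, α>0, β>0, λ>0, γ>0, r>0, c ∈ (0,1) with 1−λγ > 0. Set A := μ² + ρμ + αρ and B := α(μ(μ+ρ) + (1−λγ)(1−c)/(2r)). If P₁ and P₂ are bounded, three times continuously differentiable functions [0,∞) → ℝ each satisfying P‴ + (α−ρ)P″ − AP′ − BP + αμβ(μ+ρ) = 0 on [0,∞), and if P₁(0) = P₂(0) and P₁′(0) = P₂′(0), then P₁ = P₂. In other words, the third-order ODE has at most one bounded solution with prescribed initial value and initial derivative. -/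
open Set

lemma monotoneOn_Ici_of_hasDerivWithinAt_nonneg {f f' : ℝ → ℝ}
    (hf : ∀ t ≥ (0 : ℝ), HasDerivWithinAt f (f' t) (Ici 0) t) (hf' : ∀ t ≥ (0 : ℝ), 0 ≤ f' t) :
    MonotoneOn f (Ici 0) := by
  refine monotoneOn_of_hasDerivWithinAt_nonneg (f' := f') (convex_Ici 0)
    (fun t ht => (hf t ht).continuousWithinAt) (fun t ht => ?_) (fun t ht => ?_)
  · exact (hf t (interior_subset ht)).mono interior_subset
  · exact hf' t (interior_subset ht)

lemma hasDerivWithinAt_exp_const_mul (z t : ℝ) (s : Set ℝ) :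
    HasDerivWithinAt (fun t => Real.exp (z * t)) (z * Real.exp (z * t)) s t := by
  have h := ((hasDerivAt_id t).const_mul z).exp.hasDerivWithinAt (s := s)
  simpa [mul_comm] using h

/-- A solution of `w' = z w` on `[0, ∞)` is a multiple of the exponential. -/
lemma eq_mul_exp_of_hasDerivWithinAt {w : ℝ → ℝ} {z : ℝ}
    (hw : ∀ t ≥ (0 : ℝ), HasDerivWithinAt w (z * w t) (Ici 0) t) {t : ℝ} (ht : 0 ≤ t) :
    w t = w 0 * Real.exp (z * t) := by
  have hd : ∀ t ≥ (0 : ℝ),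
      HasDerivWithinAt (fun t => w t * Real.exp (-z * t)) 0 (Ici 0) t := fun t ht =>
    ((hw t ht).mul (hasDerivWithinAt_exp_const_mul (-z) t _)).congr_deriv (by ring)
  have hup := monotoneOn_Ici_of_hasDerivWithinAt_nonneg hd (fun _ _ => le_rfl)
    self_mem_Ici ht ht
  have hdown := monotoneOn_Ici_of_hasDerivWithinAt_nonneg
    (fun t ht => (hd t ht).neg.congr_deriv neg_zero) (fun _ _ => le_rfl) self_mem_Ici ht ht
  simp only [Pi.neg_apply, mul_zero, Real.exp_zero, mul_one] at hup hdown
  have heq : w t * Real.exp (-z * t) = w 0 := by linarith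
  rw [← heq, mul_assoc, ← Real.exp_add]
  simp

/-- A quadratic polynomial cannot dominate a growing exponential on `[0, ∞)`. -/
lemma nonpos_of_mul_exp_le_quadratic {k z a b c : ℝ} (hz : 0 < z)
    (h : ∀ t ≥ (0 : ℝ), k * Real.exp (z * t) ≤ a + b * t + c * t ^ 2) : k ≤ 0 := by
  by_contra! hk
  set N := |a| + |b| + |c| with hN
  have hN0 : 0 ≤ N := by positivity
  set κ := k * z ^ 3 / 6 with hκ
  have hκ0 : 0 < κ := by positivity
  set t := 1 + N / κ with ht
  have ht1 : 1 ≤ t := by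
    have : 0 ≤ N / κ := by positivity
    linarith
  have hκt : κ * t = κ + N := by rw [ht]; field_simp
  have hexp := Real.pow_div_factorial_le_exp (z * t) (by positivity) 3
  have hlow : κ * t ^ 3 ≤ k * Real.exp (z * t) := by
    calc κ * t ^ 3 = k * ((z * t) ^ 3 / (Nat.factorial 3 : ℝ)) := by
          rw [hκ]; norm_num [Nat.factorial]; ring
      _ ≤ _ := by gcongr
  have hle := h t (by linarith)
  have ht2 : t ≤ t ^ 2 := by nlinarith
  have h1 : a ≤ |a| * t ^ 2 := by nlinarith [le_abs_self a, abs_nonneg a]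
  have h2 : b * t ≤ |b| * t ^ 2 := by nlinarith [le_abs_self b, abs_nonneg b]
  have h3 : c * t ^ 2 ≤ |c| * t ^ 2 := by gcongr; exact le_abs_self c
  have h4 : κ * t ^ 3 = (κ + N) * t ^ 2 := by rw [← hκt]; ring
  have h5 : 0 < κ * t ^ 2 := by positivity
  nlinarith

/-- A bounded solution of `P'' + p P' + q P = k exp (z t)` with `z > 0` forces `k ≤ 0`. -/
lemma nonpos_of_bounded_of_forced_eq {P Q R : ℝ → ℝ} {p q k z M : ℝ}
    (hp : 0 ≤ p) (hq : 0 ≤ q) (hz : 0 < z) (hM : ∀ t ≥ (0 : ℝ), |P t| ≤ M)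
    (hP : ∀ t ≥ (0 : ℝ), HasDerivWithinAt P (Q t) (Ici 0) t)
    (hQ : ∀ t ≥ (0 : ℝ), HasDerivWithinAt Q (R t) (Ici 0) t)
    (heq : ∀ t ≥ (0 : ℝ), R t + p * Q t + q * P t = k * Real.exp (z * t)) : k ≤ 0 := by
  have hPM : ∀ t ≥ (0 : ℝ), P t ≤ M := fun t ht => (le_abs_self _).trans (hM t ht)
  have hE (t : ℝ) := hasDerivWithinAt_exp_const_mul z t (Ici 0)
  have hI (t : ℝ) := hasDerivWithinAt_id t (Ici (0 : ℝ))
  have hmono₁ := monotoneOn_Ici_of_hasDerivWithinAt_nonneg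
    (f := fun t => Q t + p * P t - k / z * Real.exp (z * t) + q * M * t)
    (f' := fun t => q * (M - P t))
    (fun t ht => ((((hQ t ht).add ((hP t ht).const_mul p)).sub ((hE t).const_mul (k / z))).add
      ((hI t).const_mul (q * M))).congr_deriv (by
        have := heq t ht
        field_simp
        linear_combination this))
    (fun t ht => mul_nonneg hq (sub_nonneg.2 (hPM t ht)))
  set C := Q 0 + p * P 0 - k / z with hC
  have hQlow : ∀ t ≥ (0 : ℝ), C + k / z * Real.exp (z * t) - q * M * t - p * M ≤ Q t := by
    intro t ht
    have h := hmono₁ self_mem_Ici ht ht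
    simp only [mul_zero, Real.exp_zero, mul_one, add_zero] at h
    have := mul_le_mul_of_nonneg_left (hPM t ht) hp
    linarith
  have hmono₂ := monotoneOn_Ici_of_hasDerivWithinAt_nonneg
    (f := fun t => P t - k / z ^ 2 * Real.exp (z * t) + q * M / 2 * (t * t) + (p * M - C) * t)
    (f' := fun t => Q t - (C + k / z * Real.exp (z * t) - q * M * t - p * M))
    (fun t ht => ((((hP t ht).sub ((hE t).const_mul (k / z ^ 2))).add
      (((hI t).mul (hI t)).const_mul (q * M / 2))).add
      ((hI t).const_mul (p * M - C))).congr_deriv (by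
        simp only [id]
        field_simp
        ring))
    (fun t ht => sub_nonneg.2 (hQlow t ht))
  have hk : k / z ^ 2 ≤ 0 := by
    refine nonpos_of_mul_exp_le_quadratic (a := M - P 0 + k / z ^ 2) (b := p * M - C)
      (c := q * M / 2) hz fun t ht => ?_
    have h := hmono₂ self_mem_Ici ht ht
    simp only [mul_zero, Real.exp_zero, mul_one, add_zero] at h
    linarith [hPM t ht]
  by_contra! hk'
  exact absurd hk (not_le.2 (by positivity))

/-- A damped oscillator starting at rest at the origin stays there. -/
lemma eq_zero_of_damped_oscillator {P Q R : ℝ → ℝ} {p q : ℝ} (hp : 0 ≤ p) (hq : 0 < q)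
    (hP : ∀ t ≥ (0 : ℝ), HasDerivWithinAt P (Q t) (Ici 0) t)
    (hQ : ∀ t ≥ (0 : ℝ), HasDerivWithinAt Q (R t) (Ici 0) t)
    (heq : ∀ t ≥ (0 : ℝ), R t + p * Q t + q * P t = 0)
    (hP0 : P 0 = 0) (hQ0 : Q 0 = 0) {t : ℝ} (ht : 0 ≤ t) : P t = 0 := by
  have hmono := monotoneOn_Ici_of_hasDerivWithinAt_nonneg
    (f := fun t => -(Q t * Q t + q * (P t * P t))) (f' := fun t => 2 * p * Q t ^ 2)
    (fun t ht => (((hQ t ht).mul (hQ t ht)).add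
      (((hP t ht).mul (hP t ht)).const_mul q)).neg.congr_deriv (by
        linear_combination (-2 * Q t) * heq t ht))
    (fun t _ => by positivity)
  have h := hmono self_mem_Ici ht ht
  simp only [hP0, hQ0] at h
  have hsq : q * P t ^ 2 ≤ 0 := by nlinarith [sq_nonneg (Q t)]
  have : P t ^ 2 ≤ 0 := by
    by_contra! hpos
    exact absurd hsq (not_le.2 (by positivity))
  exact pow_eq_zero_iff two_ne_zero |>.1 (le_antisymm this (sq_nonneg _))

lemma exists_pos_root_cubic {a A B : ℝ} (hA : 0 < A) (hB : 0 < B) :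
    ∃ z > 0, z ^ 3 + a * z ^ 2 - A * z - B = 0 := by
  set X := 1 + |a| + A + B with hX
  have ha := abs_nonneg a
  have hX1 : 1 ≤ X := by linarith
  have hcont : ContinuousOn (fun z : ℝ => z ^ 3 + a * z ^ 2 - A * z - B) (Icc 0 X) := by
    fun_prop
  have hval : 0 ≤ X ^ 3 + a * X ^ 2 - A * X - B := by
    have h1 : -|a| * X ^ 2 ≤ a * X ^ 2 := by gcongr; exact neg_abs_le a
    have hX2 : X ≤ X ^ 2 := by nlinarith
    have h2 : A * X ≤ A * X ^ 2 := by gcongr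
    have h3 : B ≤ B * X ^ 2 := by nlinarith
    have h4 : X ^ 3 = X ^ 2 + |a| * X ^ 2 + A * X ^ 2 + B * X ^ 2 := by
      rw [pow_succ]
      nth_rewrite 2 [hX]
      ring
    nlinarith
  obtain ⟨z, hz, hz0⟩ := intermediate_value_Icc (by linarith : (0 : ℝ) ≤ X) hcont
    (show (0 : ℝ) ∈ Icc _ _ from ⟨by simp [hB.le], hval⟩)
  refine ⟨z, lt_of_le_of_ne hz.1 ?_, hz0⟩
  rintro rfl
  simp only [ne_eq, OfNat.ofNat_ne_zero, not_false_eq_true, zero_pow, mul_zero] at hz0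
  linarith

/-- A bounded solution of `P''' + a P'' - A P' - B P = 0` on `[0, ∞)` with `A, B > 0` vanishes as
soon as `P 0 = P' 0 = 0`. -/
lemma eq_zero_of_bounded_of_third_order {P Q R S : ℝ → ℝ} {a A B M : ℝ} (hA : 0 < A) (hB : 0 < B)
    (hM : ∀ t ≥ (0 : ℝ), |P t| ≤ M)
    (hP : ∀ t ≥ (0 : ℝ), HasDerivWithinAt P (Q t) (Ici 0) t)
    (hQ : ∀ t ≥ (0 : ℝ), HasDerivWithinAt Q (R t) (Ici 0) t)
    (hR : ∀ t ≥ (0 : ℝ), HasDerivWithinAt R (S t) (Ici 0) t)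
    (heq : ∀ t ≥ (0 : ℝ), S t + a * R t - A * Q t - B * P t = 0)
    (hP0 : P 0 = 0) (hQ0 : Q 0 = 0) {t : ℝ} (ht : 0 ≤ t) : P t = 0 := by
  obtain ⟨z, hz, hroot⟩ := exists_pos_root_cubic (a := a) hA hB
  set p := a + z with hpdef
  set q := z * p - A with hqdef
  have hzq : z * q = B := by rw [hqdef, hpdef]; linear_combination hroot
  have hq : 0 < q := pos_of_mul_pos_right (hzq ▸ hB) hz.le
  have hp : 0 < p := pos_of_mul_pos_right (by linarith : 0 < z * p) hz.le
  have hw : ∀ t ≥ (0 : ℝ), HasDerivWithinAt (fun t => R t + p * Q t + q * P t)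
      (z * (R t + p * Q t + q * P t)) (Ici 0) t := fun t ht =>
    (((hR t ht).add ((hQ t ht).const_mul p)).add ((hP t ht).const_mul q)).congr_deriv (by
      linear_combination heq t ht - P t * hzq + R t * hpdef + Q t * hqdef)
  have hforced : ∀ t ≥ (0 : ℝ),
      R t + p * Q t + q * P t = (R 0 + p * Q 0 + q * P 0) * Real.exp (z * t) :=
    fun t ht => eq_mul_exp_of_hasDerivWithinAt hw ht
  have hle := nonpos_of_bounded_of_forced_eq hp.le hq.le hz hM hP hQ hforced
  have hge := nonpos_of_bounded_of_forced_eq (P := -P) (Q := -Q) (R := -R)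
    (k := -(R 0 + p * Q 0 + q * P 0)) hp.le hq.le hz
    (fun t ht => by simpa using hM t ht) (fun t ht => (hP t ht).neg) (fun t ht => (hQ t ht).neg)
    (fun t ht => by
      simp only [Pi.neg_apply]
      linear_combination -hforced t ht)
  have hk : R 0 + p * Q 0 + q * P 0 = 0 := by linarith
  exact eq_zero_of_damped_oscillator hp.le hq hP hQ
    (fun t ht => by rw [hforced t ht, hk, zero_mul]) hP0 hQ0 ht

/-- With `A = μ² + ρμ + αρ` and `B = α(μ(μ+ρ) + (1−λγ)(1−c)/(2r))`, the
third-order ODE `P''' + (α−ρ)P'' − AP' − BP + αμβ(μ+ρ) = 0` on `[0,∞)` has at most one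
bounded C³ solution with prescribed initial value and initial derivative: two such
solutions with the same `P(0)` and `P'(0)` coincide on `[0,∞)`. -/
theorem stmt_16 (ρ μ α β lam γ r c : ℝ)
    (hρ : 0 < ρ) (hμ : 0 < μ) (hα : 0 < α) (hβ : 0 < β) (hlam : 0 < lam) (hγ : 0 < γ)
    (hr : 0 < r) (hc : c ∈ Ioo (0 : ℝ) 1) (hlg : 0 < 1 - lam * γ)
    (P₁ Q₁ R₁ S₁ P₂ Q₂ R₂ S₂ : ℝ → ℝ)
    (hbd₁ : ∃ M : ℝ, ∀ t ≥ (0 : ℝ), |P₁ t| ≤ M)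
    (hbd₂ : ∃ M : ℝ, ∀ t ≥ (0 : ℝ), |P₂ t| ≤ M)
    (hC₁ : ContDiffOn ℝ 3 P₁ (Ici 0)) (hC₂ : ContDiffOn ℝ 3 P₂ (Ici 0))
    (hd₁ : ∀ t ≥ (0 : ℝ), HasDerivWithinAt P₁ (Q₁ t) (Ici 0) t)
    (hd₁' : ∀ t ≥ (0 : ℝ), HasDerivWithinAt Q₁ (R₁ t) (Ici 0) t)
    (hd₁'' : ∀ t ≥ (0 : ℝ), HasDerivWithinAt R₁ (S₁ t) (Ici 0) t)
    (hS₁ : ContinuousOn S₁ (Ici 0))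
    (hd₂ : ∀ t ≥ (0 : ℝ), HasDerivWithinAt P₂ (Q₂ t) (Ici 0) t)
    (hd₂' : ∀ t ≥ (0 : ℝ), HasDerivWithinAt Q₂ (R₂ t) (Ici 0) t)
    (hd₂'' : ∀ t ≥ (0 : ℝ), HasDerivWithinAt R₂ (S₂ t) (Ici 0) t)
    (hS₂ : ContinuousOn S₂ (Ici 0))
    (hode₁ : ∀ t ≥ (0 : ℝ),
      S₁ t + (α - ρ) * R₁ t - (μ ^ 2 + ρ * μ + α * ρ) * Q₁ t -
        (α * (μ * (μ + ρ) + (1 - lam * γ) * (1 - c) / (2 * r))) * P₁ t +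
        α * μ * β * (μ + ρ) = 0)
    (hode₂ : ∀ t ≥ (0 : ℝ),
      S₂ t + (α - ρ) * R₂ t - (μ ^ 2 + ρ * μ + α * ρ) * Q₂ t -
        (α * (μ * (μ + ρ) + (1 - lam * γ) * (1 - c) / (2 * r))) * P₂ t +
        α * μ * β * (μ + ρ) = 0)
    (h0 : P₁ 0 = P₂ 0) (h0' : Q₁ 0 = Q₂ 0) :
    EqOn P₁ P₂ (Ici 0) := by
  obtain ⟨M₁, hM₁⟩ := hbd₁
  obtain ⟨M₂, hM₂⟩ := hbd₂
  have hc' : 0 < 1 - c := sub_pos.2 hc.2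
  intro t ht
  refine sub_eq_zero.1 (eq_zero_of_bounded_of_third_order
    (P := P₁ - P₂) (Q := Q₁ - Q₂) (R := R₁ - R₂) (S := S₁ - S₂) (a := α - ρ)
    (A := μ ^ 2 + ρ * μ + α * ρ)
    (B := α * (μ * (μ + ρ) + (1 - lam * γ) * (1 - c) / (2 * r))) (M := M₁ + M₂)
    (by positivity) (by positivity)
    (fun t ht => (abs_sub _ _).trans (add_le_add (hM₁ t ht) (hM₂ t ht)))
    (fun t ht => (hd₁ t ht).sub (hd₂ t ht)) (fun t ht => (hd₁' t ht).sub (hd₂' t ht))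
    (fun t ht => (hd₁'' t ht).sub (hd₂'' t ht)) (fun t ht => ?_)
    (sub_eq_zero.2 h0) (sub_eq_zero.2 h0') ht)
  simp only [Pi.sub_apply]
  linear_combination hode₁ t ht - hode₂ t ht
end
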